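/- For a projection map π : R^{n+m} → R^n and a semialgebraic set C ⊆ R^{n+m}, the image π(C) is semialgebraic (Tarski–Seidenberg). Consequently, for any semialgebraic C ⊆ R^n × R^m, the set {x ∈ R^n : ∀ y ∈ R^m, (x,y) ∈ C} is also semialgebraic. -/

import Mathlib

open MvPolynomial

/-- The class of semialgebraic subsets of `ι → ℝ`: the smallest class containing
`{v | p(v) > 0}` for every real polynomial `p` and closed under finite unions,
finite intersections, and complements. -/
inductive IsSemialgebraic {ι : Type*} : Set (ι → ℝ) → Prop
  | basic (p : MvPolynomial ι ℝ) : IsSemialgebraic {v | 0 < eval v p}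
  | union {A B : Set (ι → ℝ)} : IsSemialgebraic A → IsSemialgebraic B →
      IsSemialgebraic (A ∪ B)
  | inter {A B : Set (ι → ℝ)} : IsSemialgebraic A → IsSemialgebraic B →
      IsSemialgebraic (A ∩ B)
  | compl {A : Set (ι → ℝ)} : IsSemialgebraic A → IsSemialgebraic Aᶜ

namespace TS

theorem sa_univ {ι : Type*} : IsSemialgebraic (Set.univ : Set (ι → ℝ)) := by
  have := IsSemialgebraic.basic (1 : MvPolynomial ι ℝ)
  simpa using this

theorem sa_empty {ι : Type*} : IsSemialgebraic (∅ : Set (ι → ℝ)) := by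
  have := (sa_univ (ι := ι)).compl
  simpa using this

theorem sa_sign {ι : Type*} (q : MvPolynomial ι ℝ) (s : SignType) :
    IsSemialgebraic {v : ι → ℝ | SignType.sign (eval v q) = s} := by
  have hp := IsSemialgebraic.basic q
  have hn := IsSemialgebraic.basic (-q)
  cases s with
  | zero =>
    convert hp.compl.inter hn.compl using 1
    ext v
    simp [le_antisymm_iff]
  | neg =>
    convert hn using 1
    ext v
    simp [sign_eq_neg_one_iff]
  | pos =>
    convert hp using 1
    ext v
    simp [sign_eq_one_iff]

/-- Same signs on a finite set of polynomials. -/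
def SameSign {ι : Type*} (Q : Finset (MvPolynomial ι ℝ)) (v w : ι → ℝ) : Prop :=
  ∀ q ∈ Q, SignType.sign (eval v q) = SignType.sign (eval w q)

theorem sa_of_invariant {ι : Type*} (Q : Finset (MvPolynomial ι ℝ)) :
    ∀ S : Set (ι → ℝ), (∀ v w, SameSign Q v w → v ∈ S → w ∈ S) → IsSemialgebraic S := by
  classical
  induction Q using Finset.induction_on with
  | empty =>
    intro S hS
    rcases S.eq_empty_or_nonempty with h | ⟨v, hv⟩
    · rw [h]; exact sa_empty
    · have : S = Set.univ := Set.eq_univ_of_forall fun w => hS v w (by simp [SameSign]) hv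
      rw [this]; exact sa_univ
  | insert q Q hq ih =>
    intro S hS
    let T : SignType → Set (ι → ℝ) := fun s =>
      {x | ∃ x' ∈ S, SignType.sign (eval x' q) = s ∧ SameSign Q x' x}
    have hT : ∀ s, IsSemialgebraic (T s ∩ {v : ι → ℝ | SignType.sign (eval v q) = s}) := by
      intro s
      refine (ih (T s) ?_).inter (sa_sign q s)
      rintro v w hvw ⟨x', h1, h2, h3⟩
      exact ⟨x', h1, h2, fun p hp => (h3 p hp).trans (hvw p hp)⟩
    convert ((hT 0).union (hT 1)).union (hT (-1)) using 1
    ext x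
    constructor
    · intro hx
      have key : x ∈ T (SignType.sign (eval x q)) := ⟨x, hx, rfl, fun _ _ => rfl⟩
      rcases h : SignType.sign (eval x q) with _ | _ | _
      · rw [h] at key; exact Or.inl (Or.inl ⟨key, h⟩)
      · rw [h] at key; exact Or.inr ⟨key, h⟩
      · rw [h] at key; exact Or.inl (Or.inr ⟨key, h⟩)
    · have aux : ∀ s, x ∈ T s ∩ {v : ι → ℝ | SignType.sign (eval v q) = s} → x ∈ S := by
        rintro s ⟨⟨x', h1, h2, h3⟩, h4⟩
        refine hS x' x ?_ h1
        intro p hp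
        rcases Finset.mem_insert.1 hp with rfl | hp
        · rw [h2]; exact h4.symm
        · exact h3 p hp
      rintro ((h | h) | h) <;> exact aux _ h

theorem exists_invariant {ι : Type*} {C : Set (ι → ℝ)} (hC : IsSemialgebraic C) :
    ∃ P : Finset (MvPolynomial ι ℝ), ∀ v w, SameSign P v w → (v ∈ C ↔ w ∈ C) := by
  classical
  induction hC with
  | basic p =>
    refine ⟨{p}, fun v w h => ?_⟩
    have := h p (by simp)
    simp only [Set.mem_ofPred_eq]
    rw [← sign_eq_one_iff, ← sign_eq_one_iff, this]
  | union _ _ ihA ihB =>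
    obtain ⟨P, hP⟩ := ihA
    obtain ⟨P', hP'⟩ := ihB
    refine ⟨P ∪ P', fun v w h => ?_⟩
    rw [Set.mem_union, Set.mem_union, hP v w fun p hp => h p (by simp [hp]),
      hP' v w fun p hp => h p (by simp [hp])]
  | inter _ _ ihA ihB =>
    obtain ⟨P, hP⟩ := ihA
    obtain ⟨P', hP'⟩ := ihB
    refine ⟨P ∪ P', fun v w h => ?_⟩
    rw [Set.mem_inter_iff, Set.mem_inter_iff, hP v w fun p hp => h p (by simp [hp]),
      hP' v w fun p hp => h p (by simp [hp])]
  | compl _ ihA =>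
    obtain ⟨P, hP⟩ := ihA
    exact ⟨P, fun v w h => not_congr (hP v w h)⟩

theorem sa_preimage {ι κ : Type*} (e : ι → κ) {C : Set (ι → ℝ)} (hC : IsSemialgebraic C) :
    IsSemialgebraic {v : κ → ℝ | v ∘ e ∈ C} := by
  induction hC with
  | basic p =>
    have := IsSemialgebraic.basic (rename e p)
    simpa [eval_rename] using this
  | union _ _ ihA ihB => exact ihA.union ihB
  | inter _ _ ihA ihB => exact ihA.inter ihB
  | compl _ ihA => exact ihA.compl

/-! ### Closure under a degree-lowering operation -/

theorem exists_closure {α : Type*} (deg : α → ℕ) (ops : α → α → Finset α)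
    (hops : ∀ a g, 1 ≤ deg g → ∀ b ∈ ops a g, deg b < deg g) (F : Finset α) :
    ∃ F' : Finset α, F ⊆ F' ∧
      ∀ a ∈ F', ∀ g ∈ F', 1 ≤ deg g → deg g ≤ deg a → ops a g ⊆ F' := by
  classical
  obtain ⟨N, hN⟩ : ∃ N, ∀ a ∈ F, deg a ≤ N := ⟨F.sup deg, fun a ha => Finset.le_sup ha⟩
  have main : ∀ i : ℕ, ∃ F' : Finset α, F ⊆ F' ∧ (∀ a ∈ F', deg a ≤ N) ∧
      ∀ a ∈ F', ∀ g ∈ F', 1 ≤ deg g → N < deg g + i → deg g ≤ deg a → ops a g ⊆ F' := by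
    intro i
    induction i with
    | zero =>
      refine ⟨F, subset_rfl, hN, fun a _ g hg _ h => ?_⟩
      have := hN g hg
      omega
    | succ i ih =>
      obtain ⟨F₁, h1, h2, h3⟩ := ih
      let P := (F₁ ×ˢ F₁).filter fun p => 1 ≤ deg p.2 ∧ N < deg p.2 + (i + 1) ∧ deg p.2 ≤ deg p.1
      let New := P.biUnion fun p => ops p.1 p.2
      have hNew : ∀ b, b ∈ New → b ∈ F₁ ∨ deg b + (i + 1) ≤ N ∧ deg b ≤ N := by
        intro b hb
        obtain ⟨p, hp, hbp⟩ := Finset.mem_biUnion.1 hb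
        obtain ⟨hp1, hp2, hp3, hp4⟩ := Finset.mem_filter.1 hp
        rw [Finset.mem_product] at hp1
        by_cases hc : N < deg p.2 + i
        · exact Or.inl (h3 _ hp1.1 _ hp1.2 hp2 hc hp4 hbp)
        · have := hops _ _ hp2 b hbp
          right; omega
      refine ⟨F₁ ∪ New, h1.trans Finset.subset_union_left, ?_, ?_⟩
      · intro a ha
        rcases Finset.mem_union.1 ha with ha | ha
        · exact h2 a ha
        · rcases hNew a ha with h | h
          · exact h2 a h
          · exact h.2
      · intro a ha g hg hg1 hg2 hga
        have old : ∀ c ∈ F₁ ∪ New, N < deg c + (i + 1) → c ∈ F₁ := by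
          intro c hc hd
          rcases Finset.mem_union.1 hc with h | h
          · exact h
          · rcases hNew c h with h | h
            · exact h
            · omega
        have ha' := old a ha (by omega)
        have hg' := old g hg hg2
        intro b hb
        refine Finset.mem_union_right _ (Finset.mem_biUnion.2 ⟨(a, g), ?_, hb⟩)
        exact Finset.mem_filter.2 ⟨Finset.mem_product.2 ⟨ha', hg'⟩, hg1, hg2, hga⟩
  obtain ⟨F', h1, h2, h3⟩ := main (N + 1)
  exact ⟨F', h1, fun a ha g hg hg1 hga => h3 a ha g hg hg1 (by omega) hga⟩

/-! ### Pseudo-division -/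

theorem exists_pseudo_rem {R : Type*} [CommRing R] (g : Polynomial R) (hg : 1 ≤ g.natDegree) :
    ∀ (d : ℕ) (a : Polynomial R), a.natDegree ≤ d → ∃ (m : ℕ) (q r : Polynomial R),
      Polynomial.C g.leadingCoeff ^ m * a = q * g + r ∧ r.natDegree < g.natDegree := by
  intro d
  induction d with
  | zero =>
    intro a ha
    exact ⟨0, 0, a, by simp, by omega⟩
  | succ d ih =>
    intro a ha
    by_cases hlt : a.natDegree < g.natDegree
    · exact ⟨0, 0, a, by simp, hlt⟩
    push Not at hlt
    let b : Polynomial R := Polynomial.C g.leadingCoeff * a -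
      Polynomial.C a.leadingCoeff * Polynomial.X ^ (a.natDegree - g.natDegree) * g
    have hb : b.natDegree ≤ d := by
      refine Nat.le_of_lt_succ (lt_of_lt_of_le ?_ ha)
      have : b.natDegree ≤ a.natDegree - 1 := by
        rw [Polynomial.natDegree_le_iff_coeff_eq_zero]
        intro k hk
        simp only [b, Polynomial.coeff_sub, mul_assoc, Polynomial.coeff_C_mul,
          Polynomial.coeff_X_pow_mul']
        rcases eq_or_lt_of_le (show a.natDegree ≤ k by omega) with h | h
        · subst h
          rw [if_pos (by omega), show a.natDegree - (a.natDegree - g.natDegree) = g.natDegree by omega]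
          simp only [Polynomial.coeff_natDegree]
          ring
        · rw [Polynomial.coeff_eq_zero_of_natDegree_lt h, if_pos (by omega),
            Polynomial.coeff_eq_zero_of_natDegree_lt (show g.natDegree < _ by omega)]
          simp
      omega
    obtain ⟨m, q, r, h1, h2⟩ := ih b hb
    refine ⟨m + 1, Polynomial.C g.leadingCoeff ^ m * (Polynomial.C a.leadingCoeff *
      Polynomial.X ^ (a.natDegree - g.natDegree)) + q, r, ?_, h2⟩
    have : Polynomial.C g.leadingCoeff * a = b +
      Polynomial.C a.leadingCoeff * Polynomial.X ^ (a.natDegree - g.natDegree) * g := by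
      simp [b]
    rw [pow_succ, mul_assoc, this, mul_add, h1]
    ring

/-! ### Moving a point by an order isomorphism -/

noncomputable def pl (l u p q t : ℝ) : ℝ :=
  if t ≤ l ∨ u ≤ t then t else
    if t ≤ p then l + (t - l) * ((q - l) / (p - l)) else u - (u - t) * ((u - q) / (u - p))

theorem pl_inv {l u p q : ℝ} (h1 : l < p) (h2 : p < u) (h3 : l < q) (h4 : q < u) (t : ℝ) :
    pl l u q p (pl l u p q t) = t := by
  have e1 : 0 < p - l := by linarith
  have e2 : 0 < u - p := by linarith
  have e3 : 0 < q - l := by linarith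
  have e4 : 0 < u - q := by linarith
  by_cases ht : t ≤ l ∨ u ≤ t
  · simp [pl, ht]
  have ht' := ht
  push Not at ht'
  by_cases htp : t ≤ p
  · have hv : pl l u p q t = l + (t - l) * ((q - l) / (p - l)) := by simp [pl, ht, htp]
    have a1 : 0 < (t - l) * ((q - l) / (p - l)) := mul_pos (by linarith) (by positivity)
    have a2 : (t - l) * ((q - l) / (p - l)) ≤ q - l := by
      rw [mul_div_assoc', div_le_iff₀ e1]
      nlinarith
    rw [hv, pl, if_neg (by push Not; constructor <;> linarith), if_pos (by linarith)]
    field_simp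
    ring
  · have hv : pl l u p q t = u - (u - t) * ((u - q) / (u - p)) := by simp [pl, ht, htp]
    push Not at htp
    have a1 : 0 < (u - t) * ((u - q) / (u - p)) := mul_pos (by linarith) (by positivity)
    have a2 : (u - t) * ((u - q) / (u - p)) < u - q := by
      rw [mul_div_assoc', div_lt_iff₀ e2]
      nlinarith
    rw [hv, pl, if_neg (by push Not; constructor <;> linarith), if_neg (by linarith)]
    field_simp
    ring

theorem pl_mono {l u p q : ℝ} (h1 : l < p) (h2 : p < u) (h3 : l < q) (h4 : q < u) :
    Monotone (pl l u p q) := by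
  have e1 : 0 < p - l := by linarith
  have e2 : 0 < u - p := by linarith
  have e3 : 0 < q - l := by linarith
  have e4 : 0 < u - q := by linarith
  have b1 : 0 < (q - l) / (p - l) := by positivity
  have b2 : 0 < (u - q) / (u - p) := by positivity
  have c1 : (p - l) * ((q - l) / (p - l)) = q - l := by field_simp
  have c2 : (u - p) * ((u - q) / (u - p)) = u - q := by field_simp
  intro s t hst
  unfold pl
  generalize (q - l) / (p - l) = A at *
  generalize (u - q) / (u - p) = B at *
  by_cases s1 : s ≤ l
  · by_cases t1 : t ≤ l
    · simp only [s1, t1, true_or, if_true]; exact hst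
    by_cases t2 : u ≤ t
    · simp only [s1, t2, true_or, or_true, if_true]; exact hst
    by_cases t3 : t ≤ p
    · simp only [s1, t1, t2, t3, true_or, or_self, if_true, if_false]; nlinarith
    · simp only [s1, t1, t2, t3, true_or, or_self, if_true, if_false]; nlinarith
  by_cases s2 : u ≤ s
  · have t2 : u ≤ t := s2.trans hst
    simp only [s2, t2, or_true, if_true]; exact hst
  have t1 : ¬ t ≤ l := by linarith
  by_cases t2 : u ≤ t
  · by_cases s3 : s ≤ p
    · simp only [s1, s2, s3, t1, t2, or_true, or_self, if_true, if_false]; nlinarith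
    · simp only [s1, s2, s3, t1, t2, or_true, or_self, if_true, if_false]; nlinarith
  by_cases s3 : s ≤ p
  · by_cases t3 : t ≤ p
    · simp only [s1, s2, s3, t1, t2, t3, or_self, if_true, if_false]; nlinarith
    · simp only [s1, s2, s3, t1, t2, t3, or_self, if_true, if_false]; nlinarith
  · have t3 : ¬ t ≤ p := by linarith
    simp only [s1, s2, s3, t1, t2, t3, or_self, if_false]; nlinarith

theorem exists_move {l u p q : ℝ} (h1 : l < p) (h2 : p < u) (h3 : l < q) (h4 : q < u) :
    ∃ θ : ℝ ≃o ℝ, θ p = q ∧ ∀ t, (t ≤ l ∨ u ≤ t) → θ t = t := by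
  refine ⟨Equiv.toOrderIso ⟨pl l u p q, pl l u q p, pl_inv h1 h2 h3 h4, pl_inv h3 h4 h1 h2⟩
    (pl_mono h1 h2 h3 h4) (pl_mono h3 h4 h1 h2), ?_, ?_⟩
  · have e1 : p - l ≠ 0 := by linarith
    change pl l u p q p = q
    rw [pl, if_neg (by push Not; exact ⟨h1, h2⟩), if_pos le_rfl]
    field_simp
    ring
  · intro t ht
    change pl l u p q t = t
    simp [pl, ht]


/-! ### Real analysis on one cell -/

theorem cell_root {l u r : ℝ} {g h : ℝ → ℝ} (hh : Continuous h)
    (mg : StrictMonoOn g (Set.Icc l u))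
    (hl : SignType.sign (g l) = SignType.sign (h l))
    (hu : SignType.sign (g u) = SignType.sign (h u)) (hr : r ∈ Set.Ioo l u) (h0 : g r = 0) :
    ∃ r' ∈ Set.Ioo l u, h r' = 0 := by
  have hlu : l < u := hr.1.trans hr.2
  have g1 : g l < 0 := h0 ▸ mg ⟨le_rfl, hlu.le⟩ ⟨hr.1.le, hr.2.le⟩ hr.1
  have g2 : 0 < g u := h0 ▸ mg ⟨hr.1.le, hr.2.le⟩ ⟨hlu.le, le_rfl⟩ hr.2
  rw [sign_neg g1] at hl
  rw [sign_pos g2] at hu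
  have k1 : h l < 0 := sign_eq_neg_one_iff.1 hl.symm
  have k2 : 0 < h u := sign_eq_one_iff.1 hu.symm
  exact intermediate_value_Ioo hlu.le hh.continuousOn ⟨k1, k2⟩

theorem cell_sign {l u t : ℝ} {g k : ℝ → ℝ} (hg : Continuous g)
    (mk : StrictMonoOn k (Set.Icc l u))
    (hl : SignType.sign (g l) = SignType.sign (k l))
    (hu : SignType.sign (g u) = SignType.sign (k u)) (ht : t ∈ Set.Ioo l u)
    (h0 : ∀ r ∈ Set.Ioo l u, g r = 0 → k r = 0) :
    SignType.sign (g t) = SignType.sign (k t) := by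
  have hlu : l < u := ht.1.trans ht.2
  have tm : t ∈ Set.Icc l u := ⟨ht.1.le, ht.2.le⟩
  rcases lt_trichotomy (g t) 0 with hlt | heq | hgt
  · have : k t < 0 := by
      by_cases c : g u ≤ 0
      · have : k u ≤ 0 := by
          rw [← sign_nonpos_iff, ← hu, sign_nonpos_iff]; exact c
        exact (mk tm ⟨hlu.le, le_rfl⟩ ht.2).trans_le this
      · push Not at c
        obtain ⟨r, hr, hr0⟩ := intermediate_value_Ioo ht.2.le hg.continuousOn ⟨hlt, c⟩
        have := h0 r ⟨ht.1.trans hr.1, hr.2⟩ hr0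
        rw [← this]
        exact mk tm ⟨(ht.1.trans hr.1).le, hr.2.le⟩ hr.1
    rw [sign_neg hlt, sign_neg this]
  · rw [heq, h0 t ht heq]
  · have : 0 < k t := by
      by_cases c : 0 ≤ g l
      · have : 0 ≤ k l := by
          rw [← sign_nonneg_iff, ← hl, sign_nonneg_iff]; exact c
        exact this.trans_lt (mk ⟨le_rfl, hlu.le⟩ tm ht.1)
      · push Not at c
        obtain ⟨r, hr, hr0⟩ := intermediate_value_Ioo ht.1.le hg.continuousOn ⟨c, hgt⟩
        have := h0 r ⟨hr.1, hr.2.trans ht.2⟩ hr0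
        rw [← this]
        exact mk ⟨hr.1.le, (hr.2.trans ht.2).le⟩ tm hr.2
    rw [sign_pos hgt, sign_pos this]

theorem exists_cell (Z : Finset ℝ) {a b t : ℝ} (ha : a ∈ Z) (hb : b ∈ Z) (hat : a < t)
    (htb : t < b) (ht : t ∉ Z) :
    ∃ l ∈ Z, ∃ u ∈ Z, l < t ∧ t < u ∧ a ≤ l ∧ u ≤ b ∧ ∀ s ∈ Set.Ioo l u, s ∉ Z := by
  obtain ⟨l, hl, hl'⟩ := (Z.filter (· < t)).exists_max_image id ⟨a, by simp [ha, hat]⟩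
  obtain ⟨u, hu, hu'⟩ := (Z.filter (t < ·)).exists_min_image id ⟨b, by simp [hb, htb]⟩
  simp only [Finset.mem_filter, id, and_imp] at hl hl' hu hu'
  refine ⟨l, hl.1, u, hu.1, hl.2, hu.2, hl' a ha hat, hu' b hb htb, ?_⟩
  intro s hs hsZ
  rcases lt_trichotomy s t with h | h | h
  · exact absurd (hl' s hsZ h) (not_le.2 hs.1)
  · exact ht (h ▸ hsZ)
  · exact absurd (hu' s hsZ h) (not_le.2 hs.2)

theorem adjust (Z : Finset ℝ) (g h : ℝ → ℝ) (hg : Continuous g) (hh : Continuous h)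
    (hZ : ∀ z ∈ Z, SignType.sign (g z) = SignType.sign (h z))
    (hcell : ∀ l u, l < u → (∀ t ∈ Set.Ioo l u, t ∉ Z) →
      (StrictMonoOn g (Set.Icc l u) ∧ StrictMonoOn h (Set.Icc l u)) ∨
      (StrictAntiOn g (Set.Icc l u) ∧ StrictAntiOn h (Set.Icc l u)))
    (a b : ℝ) (ha : a ∈ Z) (hb : b ∈ Z)
    (hout : ∀ t, t ≤ a ∨ b ≤ t → SignType.sign (g t) = SignType.sign (h t))
    (R : Finset ℝ) (hR : ∀ t, t ∈ R ↔ g t = 0) :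
    ∃ ψ : ℝ ≃o ℝ, (∀ z ∈ Z, ψ z = z) ∧ ∀ t, SignType.sign (g t) = SignType.sign (h (ψ t)) := by
  have main : ∀ S : Finset ℝ, (∀ r ∈ S, g r = 0) → ∃ ψ : ℝ ≃o ℝ, (∀ z ∈ Z, ψ z = z) ∧
      (∀ t, t ≤ a ∨ b ≤ t → ψ t = t) ∧ ∀ r ∈ S, h (ψ r) = 0 := by
    intro S
    induction S using Finset.induction_on with
    | empty => exact fun _ => ⟨OrderIso.refl ℝ, by simp, by simp, by simp⟩
    | insert r S hrS ih =>
      intro hS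
      obtain ⟨ψ, p1, p2, p3⟩ := ih fun s hs => hS s (Finset.mem_insert_of_mem hs)
      have hr : g r = 0 := hS r (Finset.mem_insert_self _ _)
      by_cases hrb : r ≤ a ∨ b ≤ r
      · refine ⟨ψ, p1, p2, fun s hs => ?_⟩
        rcases Finset.mem_insert.1 hs with rfl | hs
        · rw [p2 _ hrb, ← sign_eq_zero_iff, ← hout _ hrb, hr, sign_zero]
        · exact p3 s hs
      by_cases hrZ : r ∈ Z
      · refine ⟨ψ, p1, p2, fun s hs => ?_⟩
        rcases Finset.mem_insert.1 hs with rfl | hs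
        · rw [p1 _ hrZ, ← sign_eq_zero_iff, ← hZ _ hrZ, hr, sign_zero]
        · exact p3 s hs
      push Not at hrb
      obtain ⟨l, hl, u, hu, hlr, hru, hal, hub, hlu⟩ := exists_cell Z ha hb hrb.1 hrb.2 hrZ
      have hc := hcell l u (hlr.trans hru) hlu
      have hroot : ∃ r' ∈ Set.Ioo l u, h r' = 0 := by
        rcases hc with ⟨m1, m2⟩ | ⟨m1, m2⟩
        · exact cell_root hh m1 (hZ l hl) (hZ u hu) ⟨hlr, hru⟩ hr
        · have := cell_root (g := fun t => - g t) (h := fun t => - h t) (l := l) (u := u) (r := r)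
            hh.neg m1.neg (by simp [Left.sign_neg, hZ l hl]) (by simp [Left.sign_neg, hZ u hu])
            ⟨hlr, hru⟩ (by simp [hr])
          simpa using this
      have hinj : Set.InjOn g (Set.Icc l u) := by
        rcases hc with ⟨m1, m2⟩ | ⟨m1, m2⟩
        · exact m1.injOn
        · exact m1.injOn
      obtain ⟨r', hr', hr'0⟩ := hroot
      have q1 : l < ψ r := by rw [← p1 l hl]; exact ψ.strictMono hlr
      have q2 : ψ r < u := by rw [← p1 u hu]; exact ψ.strictMono hru
      obtain ⟨θ, t1, t2⟩ := exists_move q1 q2 hr'.1 hr'.2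
      refine ⟨ψ.trans θ, ?_, ?_, ?_⟩
      · intro z hz
        rw [OrderIso.trans_apply, p1 z hz]
        apply t2
        by_contra hcon
        push Not at hcon
        exact hlu z hcon hz
      · intro t ht
        rw [OrderIso.trans_apply, p2 t ht]
        apply t2
        rcases ht with ht | ht
        · left; linarith
        · right; linarith
      · intro s hs
        rw [OrderIso.trans_apply]
        rcases Finset.mem_insert.1 hs with rfl | hs
        · rw [t1, hr'0]
        · rw [t2, p3 s hs]
          by_contra hcon
          push Not at hcon
          have s1 : l < s := by rw [← p1 l hl] at hcon; exact ψ.lt_iff_lt.1 hcon.1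
          have s2 : s < u := by rw [← p1 u hu] at hcon; exact ψ.lt_iff_lt.1 hcon.2
          have : s = r := hinj ⟨s1.le, s2.le⟩ ⟨hlr.le, hru.le⟩
            ((hS s (Finset.mem_insert_of_mem hs)).trans hr.symm)
          exact hrS (this ▸ hs)
  obtain ⟨ψ, p1, p2, p3⟩ := main R fun r hr => (hR r).1 hr
  refine ⟨ψ, p1, fun t => ?_⟩
  by_cases htb : t ≤ a ∨ b ≤ t
  · rw [p2 t htb, hout t htb]
  by_cases htZ : t ∈ Z
  · rw [p1 t htZ, hZ t htZ]
  push Not at htb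
  obtain ⟨l, hl, u, hu, hlr, hru, hal, hub, hlu⟩ := exists_cell Z ha hb htb.1 htb.2 htZ
  have hmaps : Set.MapsTo ψ (Set.Icc l u) (Set.Icc l u) := by
    intro s hs
    constructor
    · rw [← p1 l hl]; exact ψ.monotone hs.1
    · rw [← p1 u hu]; exact ψ.monotone hs.2
  have el : SignType.sign (g l) = SignType.sign (h (ψ l)) := by rw [p1 l hl, hZ l hl]
  have eu : SignType.sign (g u) = SignType.sign (h (ψ u)) := by rw [p1 u hu, hZ u hu]
  rcases hcell l u (hlr.trans hru) hlu with ⟨m1, m2⟩ | ⟨m1, m2⟩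
  · exact cell_sign (k := fun t => h (ψ t)) hg
      (fun x hx y hy hxy => m2 (hmaps hx) (hmaps hy) (ψ.strictMono hxy)) el eu ⟨hlr, hru⟩
      (fun r _ h0 => p3 r ((hR r).2 h0))
  · have := cell_sign (g := fun t => - g t) (k := fun t => - h (ψ t)) (l := l) (u := u) (t := t)
      hg.neg (fun x hx y hy hxy => neg_lt_neg (m2 (hmaps hx) (hmaps hy) (ψ.strictMono hxy)))
      (by simp [Left.sign_neg, el]) (by simp [Left.sign_neg, eu]) ⟨hlr, hru⟩
      (fun r _ h0 => by simpa using p3 r ((hR r).2 (by simpa using h0)))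
    simpa [Left.sign_neg] using this

/-! ### Polynomials -/

theorem ev_top (P : Polynomial ℝ) (hP : 0 < P.natDegree) :
    ∀ᶠ t in Filter.atTop, SignType.sign (P.eval t) = SignType.sign P.leadingCoeff := by
  have hd : 0 < P.degree := Polynomial.natDegree_pos_iff_degree_pos.1 hP
  have hne : P.leadingCoeff ≠ 0 := Polynomial.leadingCoeff_ne_zero.2 (Polynomial.ne_zero_of_degree_gt hd)
  rcases lt_or_gt_of_ne hne with h | h
  · filter_upwards [(P.tendsto_atBot_of_leadingCoeff_nonpos hd h.le).eventually
      (Filter.eventually_lt_atBot 0)] with t ht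
    rw [sign_neg ht, sign_neg h]
  · filter_upwards [(P.tendsto_atTop_of_leadingCoeff_nonneg hd h.le).eventually
      (Filter.eventually_gt_atTop 0)] with t ht
    rw [sign_pos ht, sign_pos h]

theorem ev_bot (P : Polynomial ℝ) (hP : 0 < P.natDegree) :
    ∀ᶠ t in Filter.atBot, SignType.sign (P.eval t) =
      SignType.sign P.leadingCoeff * SignType.sign ((-1 : ℝ) ^ P.natDegree) := by
  have h1 : (P.comp (-Polynomial.X)).natDegree = P.natDegree := by
    rw [Polynomial.natDegree_comp]; simp
  have h2 : (P.comp (-Polynomial.X)).leadingCoeff = P.leadingCoeff * (-1) ^ P.natDegree := by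
    rw [Polynomial.leadingCoeff_comp (by simp)]; simp
  have h := ev_top (P.comp (-Polynomial.X)) (by rw [h1]; exact hP)
  filter_upwards [Filter.tendsto_neg_atBot_atTop.eventually h] with t ht
  rw [h2, sign_mul] at ht
  simpa using ht

theorem const_sign {f : ℝ → ℝ} (hf : Continuous f) {l u : ℝ}
    (h : ∀ t ∈ Set.Ioo l u, f t ≠ 0) :
    (∀ t ∈ Set.Ioo l u, 0 < f t) ∨ (∀ t ∈ Set.Ioo l u, f t < 0) := by
  by_contra hcon
  push Not at hcon
  obtain ⟨⟨s, hs, hs0⟩, t, ht, ht0⟩ := hcon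
  obtain ⟨r, hr, hr0⟩ := isPreconnected_Ioo.intermediate_value hs ht hf.continuousOn ⟨hs0, ht0⟩
  exact h r hr hr0

theorem step (φ : ℝ ≃o ℝ) (Z : Finset ℝ) (P Q : Polynomial ℝ)
    (hdeg : P.natDegree = Q.natDegree) (hpos : 0 < P.natDegree)
    (hlc : SignType.sign P.leadingCoeff = SignType.sign Q.leadingCoeff)
    (hder : ∀ t, SignType.sign (P.derivative.eval t) = SignType.sign (Q.derivative.eval (φ t)))
    (hZd : ∀ t, P.derivative.eval t = 0 → t ∈ Z)
    (hZ : ∀ z ∈ Z, SignType.sign (P.eval z) = SignType.sign (Q.eval (φ z))) :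
    ∃ ψ : ℝ ≃o ℝ, (∀ z ∈ Z, ψ z = φ z) ∧
      ∀ t, SignType.sign (P.eval t) = SignType.sign (Q.eval (ψ t)) := by
  have hP0 : P ≠ 0 := by rintro rfl; simp at hpos
  have e1 : ∀ᶠ t in Filter.atTop, SignType.sign (P.eval t) = SignType.sign (Q.eval (φ t)) := by
    filter_upwards [ev_top P hpos, φ.tendsto_atTop.eventually (ev_top Q (hdeg ▸ hpos))] with t h1 h2
    rw [h1, h2, hlc]
  have e2 : ∀ᶠ t in Filter.atBot, SignType.sign (P.eval t) = SignType.sign (Q.eval (φ t)) := by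
    filter_upwards [ev_bot P hpos, φ.tendsto_atBot.eventually (ev_bot Q (hdeg ▸ hpos))] with t h1 h2
    rw [h1, h2, hlc, hdeg]
  obtain ⟨b, hb⟩ := Filter.eventually_atTop.1 e1
  obtain ⟨a, ha⟩ := Filter.eventually_atBot.1 e2
  have hout : ∀ t, t ≤ a ∨ b ≤ t → SignType.sign (P.eval t) = SignType.sign (Q.eval (φ t)) := by
    rintro t (h | h)
    · exact ha t h
    · exact hb t h
  obtain ⟨ψ, p1, p2⟩ := adjust (insert a (insert b Z)) (fun t => P.eval t) (fun t => Q.eval (φ t))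
    P.continuous (Q.continuous.comp φ.continuous) (by
      intro z hz
      rcases Finset.mem_insert.1 hz with rfl | hz
      · exact hout _ (Or.inl le_rfl)
      rcases Finset.mem_insert.1 hz with rfl | hz
      · exact hout _ (Or.inr le_rfl)
      exact hZ z hz) (by
      intro l u hlu hno
      have hno' : ∀ t ∈ Set.Ioo l u, P.derivative.eval t ≠ 0 := fun t ht h0 =>
        hno t ht (Finset.mem_insert_of_mem (Finset.mem_insert_of_mem (hZd t h0)))
      have hφ : ∀ s ∈ Set.Ioo (φ l) (φ u), ∃ t ∈ Set.Ioo l u, φ t = s := by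
        intro s hs
        refine ⟨φ.symm s, ⟨?_, ?_⟩, by simp⟩
        · rw [φ.lt_symm_apply]; exact hs.1
        · rw [φ.symm_apply_lt]; exact hs.2
      rcases const_sign P.derivative.continuous hno' with hs | hs
      · left
        constructor
        · refine strictMonoOn_of_deriv_pos (convex_Icc l u) P.continuous.continuousOn fun t ht => ?_
          rw [interior_Icc] at ht
          rw [Polynomial.deriv]
          exact hs t ht
        · have : StrictMonoOn (fun t => Q.eval t) (Set.Icc (φ l) (φ u)) := by
            refine strictMonoOn_of_deriv_pos (convex_Icc _ _) Q.continuous.continuousOn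
              fun s hs' => ?_
            rw [interior_Icc] at hs'
            obtain ⟨t, ht, rfl⟩ := hφ s hs'
            rw [Polynomial.deriv, ← sign_eq_one_iff, ← hder, sign_eq_one_iff]
            exact hs t ht
          exact fun x hx y hy hxy => this ⟨φ.monotone hx.1, φ.monotone hx.2⟩
            ⟨φ.monotone hy.1, φ.monotone hy.2⟩ (φ.strictMono hxy)
      · right
        constructor
        · refine strictAntiOn_of_deriv_neg (convex_Icc l u) P.continuous.continuousOn fun t ht => ?_
          rw [interior_Icc] at ht
          rw [Polynomial.deriv]
          exact hs t ht
        · have : StrictAntiOn (fun t => Q.eval t) (Set.Icc (φ l) (φ u)) := by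
            refine strictAntiOn_of_deriv_neg (convex_Icc _ _) Q.continuous.continuousOn
              fun s hs' => ?_
            rw [interior_Icc] at hs'
            obtain ⟨t, ht, rfl⟩ := hφ s hs'
            rw [Polynomial.deriv, ← sign_eq_neg_one_iff, ← hder, sign_eq_neg_one_iff]
            exact hs t ht
          exact fun x hx y hy hxy => this ⟨φ.monotone hx.1, φ.monotone hx.2⟩
            ⟨φ.monotone hy.1, φ.monotone hy.2⟩ (φ.strictMono hxy))
    a b (by simp) (by simp) hout P.roots.toFinset (by
      intro t
      rw [Multiset.mem_toFinset, Polynomial.mem_roots hP0, Polynomial.IsRoot.def])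
  refine ⟨ψ.trans φ, fun z hz => ?_, fun t => ?_⟩
  · rw [OrderIso.trans_apply, p1 z (by simp [hz])]
  · rw [OrderIso.trans_apply]; exact p2 t

theorem sign_transfer (φ ψ : ℝ ≃o ℝ) (Z : Finset ℝ) (p : Polynomial ℝ)
    (hroot : ∀ t, p.eval (φ t) = 0 → t ∈ Z) (hψ : ∀ z ∈ Z, ψ z = φ z) (t : ℝ) :
    SignType.sign (p.eval (φ t)) = SignType.sign (p.eval (ψ t)) := by
  by_cases ht : t ∈ Z
  · rw [hψ t ht]
  have key : ∀ w ∈ Set.uIcc (φ t) (ψ t), p.eval w ≠ 0 := by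
    intro w hw h0
    obtain ⟨s, rfl⟩ := φ.surjective w
    have hs := hroot s h0
    have hst : s = t := by
      rcases Set.mem_uIcc.1 hw with ⟨h1, h2⟩ | ⟨h1, h2⟩
      · rw [← hψ s hs] at h2
        exact le_antisymm (ψ.le_iff_le.1 h2) (φ.le_iff_le.1 h1)
      · rw [← hψ s hs] at h1
        exact le_antisymm (φ.le_iff_le.1 h2) (ψ.le_iff_le.1 h1)
    exact ht (hst ▸ hs)
  rcases lt_or_gt_of_ne (key _ Set.left_mem_uIcc) with h1 | h1 <;>
    rcases lt_or_gt_of_ne (key _ Set.right_mem_uIcc) with h2 | h2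
  · rw [sign_neg h1, sign_neg h2]
  · obtain ⟨w, hw, hw0⟩ := intermediate_value_uIcc (p.continuous.continuousOn (s := Set.uIcc (φ t) (ψ t)))
      (Set.mem_uIcc.2 (Or.inl ⟨h1.le, h2.le⟩))
    exact absurd hw0 (key w hw)
  · obtain ⟨w, hw, hw0⟩ := intermediate_value_uIcc (p.continuous.continuousOn (s := Set.uIcc (φ t) (ψ t)))
      (Set.mem_uIcc.2 (Or.inr ⟨h2.le, h1.le⟩))
    exact absurd hw0 (key w hw)
  · rw [sign_pos h1, sign_pos h2]

theorem sign_cancel : ∀ w u v : SignType, w ≠ 0 → w * u = w * v → u = v := by decide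


/-! ### The main induction -/

/-- Specialisation of the parameters. -/
noncomputable def ev {ι : Type*} (x : ι → ℝ) (f : Polynomial (MvPolynomial ι ℝ)) :
    Polynomial ℝ := f.map (eval x)

/-- Closedness of a family of polynomials. -/
def Closed {ι : Type*} (F : Finset (Polynomial (MvPolynomial ι ℝ))) : Prop :=
  ∀ a ∈ F, ∀ g ∈ F, 1 ≤ g.natDegree → g.natDegree ≤ a.natDegree →
    g.derivative ∈ F ∧ g.eraseLead ∈ F ∧ ∃ (m : ℕ) (q r : Polynomial (MvPolynomial ι ℝ)),
      Polynomial.C g.leadingCoeff ^ m * a = q * g + r ∧ r.natDegree < g.natDegree ∧ r ∈ F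

theorem exists_closed {ι : Type*} (F : Finset (Polynomial (MvPolynomial ι ℝ))) :
    ∃ F', F ⊆ F' ∧ Closed F' := by
  classical
  have hrem : ∀ a g : Polynomial (MvPolynomial ι ℝ), ∃ r : Polynomial (MvPolynomial ι ℝ),
      1 ≤ g.natDegree → (∃ (m : ℕ) (q : Polynomial (MvPolynomial ι ℝ)),
        Polynomial.C g.leadingCoeff ^ m * a = q * g + r) ∧ r.natDegree < g.natDegree := by
    intro a g
    by_cases hg : 1 ≤ g.natDegree
    · obtain ⟨m, q, r, h1, h2⟩ := exists_pseudo_rem g hg _ a le_rfl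
      exact ⟨r, fun _ => ⟨⟨m, q, h1⟩, h2⟩⟩
    · exact ⟨0, fun h => absurd h hg⟩
  choose rem hrem using hrem
  obtain ⟨F', h1, h2⟩ := exists_closure (fun f : Polynomial (MvPolynomial ι ℝ) => f.natDegree)
    (fun a g => {g.derivative, g.eraseLead, rem a g}) (by
      intro a g hg b hb
      simp only [Finset.mem_insert, Finset.mem_singleton] at hb
      rcases hb with rfl | rfl | rfl
      · exact Polynomial.natDegree_derivative_lt (by omega)
      · have := Polynomial.eraseLead_natDegree_le g
        change 1 ≤ g.natDegree at hg
        change g.eraseLead.natDegree < g.natDegree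
        omega
      · exact (hrem a g hg).2) F
  refine ⟨F', h1, fun a ha g hg hg1 hga => ?_⟩
  have hs := h2 a ha g hg hg1 hga
  obtain ⟨⟨m, q, hmq⟩, hd⟩ := hrem a g hg1
  exact ⟨hs (by simp), hs (by simp), m, q, rem a g, hmq, hd, hs (by simp)⟩

theorem ev_eraseLead {ι : Type*} (x : ι → ℝ) (f : Polynomial (MvPolynomial ι ℝ))
    (h : eval x f.leadingCoeff = 0) : ev x f = ev x f.eraseLead := by
  conv_lhs => rw [← Polynomial.eraseLead_add_C_mul_X_pow f]
  simp only [ev, Polynomial.map_add, Polynomial.map_mul, Polynomial.map_C, h, Polynomial.C_0,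
    zero_mul, add_zero]

theorem ev_zero_deg {ι : Type*} (x : ι → ℝ) (f : Polynomial (MvPolynomial ι ℝ))
    (h : f.natDegree = 0) : ev x f = Polynomial.C (eval x f.leadingCoeff) := by
  have h2 := Polynomial.eq_C_of_natDegree_eq_zero h
  rw [Polynomial.leadingCoeff, h]
  conv_lhs => rw [h2]
  simp [ev]

theorem main_induction {ι : Type*} (F : Finset (Polynomial (MvPolynomial ι ℝ))) (hF : Closed F)
    (x x' : ι → ℝ)
    (hx : ∀ f ∈ F, SignType.sign (eval x f.leadingCoeff) = SignType.sign (eval x' f.leadingCoeff)) :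
    ∃ φ : ℝ ≃o ℝ, ∀ f ∈ F, ∀ t, SignType.sign ((ev x f).eval t) =
      SignType.sign ((ev x' f).eval (φ t)) := by
  classical
  have key : ∀ G : Finset (Polynomial (MvPolynomial ι ℝ)), G ⊆ F →
      (∀ a ∈ G, ∀ b ∈ F, b.natDegree < a.natDegree → b ∈ G) →
      ∃ φ : ℝ ≃o ℝ, ∀ f ∈ G, ∀ t, SignType.sign ((ev x f).eval t) =
        SignType.sign ((ev x' f).eval (φ t)) := by
    intro G
    induction G using Finset.induction_on_max_value
      (fun f : Polynomial (MvPolynomial ι ℝ) => f.natDegree) with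
    | empty => exact fun _ _ => ⟨OrderIso.refl ℝ, by simp⟩
    | insert a G haG hmax ih =>
      intro hsub hdown
      have haF : a ∈ F := hsub (Finset.mem_insert_self _ _)
      have hGF : G ⊆ F := fun b hb => hsub (Finset.mem_insert_of_mem hb)
      have hlow : ∀ b ∈ F, b.natDegree < a.natDegree → b ∈ G := by
        intro b hb hlt
        rcases Finset.mem_insert.1 (hdown a (Finset.mem_insert_self _ _) b hb hlt) with h | h
        · rw [h] at hlt; exact absurd hlt (lt_irrefl _)
        · exact h
      obtain ⟨φ, hφ⟩ := ih hGF fun c hc b hb hlt => hlow b hb (hlt.trans_le (hmax c hc))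
      -- it suffices to treat the new polynomial when its leading coefficient survives
      have easy : (∀ t, SignType.sign ((ev x a).eval t) = SignType.sign ((ev x' a).eval (φ t))) →
          ∃ φ : ℝ ≃o ℝ, ∀ f ∈ insert a G, ∀ t, SignType.sign ((ev x f).eval t) =
            SignType.sign ((ev x' f).eval (φ t)) := by
        intro h
        refine ⟨φ, fun f hf => ?_⟩
        rcases Finset.mem_insert.1 hf with rfl | hf
        · exact h
        · exact hφ f hf
      by_cases ha0 : a.natDegree = 0
      · apply easy
        intro t
        rw [ev_zero_deg x a ha0, ev_zero_deg x' a ha0, Polynomial.eval_C, Polynomial.eval_C, hx a haF]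
      have ha1 : 1 ≤ a.natDegree := by omega
      obtain ⟨hda, hea, -⟩ := hF a haF a haF ha1 le_rfl
      have herase : ∀ f : Polynomial (MvPolynomial ι ℝ), 1 ≤ f.natDegree →
          f.eraseLead.natDegree < f.natDegree := by
        intro f hf
        have := Polynomial.eraseLead_natDegree_le f
        omega
      by_cases hlc : eval x a.leadingCoeff = 0
      · apply easy
        have hlc' : eval x' a.leadingCoeff = 0 := by
          rw [← sign_eq_zero_iff, ← hx a haF, hlc, sign_zero]
        rw [ev_eraseLead x a hlc, ev_eraseLead x' a hlc']
        exact hφ _ (hlow _ hea (herase a ha1))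
      have hlc' : eval x' a.leadingCoeff ≠ 0 := by
        rw [← sign_ne_zero, ← hx a haF, sign_ne_zero]; exact hlc
      -- the roots already known
      let Z : Finset ℝ := G.biUnion fun f => (ev x f).roots.toFinset
      have hZmem : ∀ f ∈ G, ev x f ≠ 0 → ∀ t, (ev x f).eval t = 0 → t ∈ Z := by
        intro f hf h0 t ht
        refine Finset.mem_biUnion.2 ⟨f, hf, ?_⟩
        rw [Multiset.mem_toFinset, Polynomial.mem_roots h0]
        exact ht
      have hgood : ∀ (d : ℕ), ∀ f ∈ G, f.natDegree ≤ d → ev x f ≠ 0 → ∀ z, (ev x f).eval z = 0 →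
          ∃ g ∈ G, eval x g.leadingCoeff ≠ 0 ∧ 1 ≤ g.natDegree ∧ (ev x g).eval z = 0 := by
        intro d
        induction d with
        | zero =>
          intro f hf hd h0 z hz
          rw [ev_zero_deg x f (by omega)] at h0 hz
          rw [Polynomial.eval_C] at hz
          rw [hz] at h0
          simp at h0
        | succ d ihd =>
          intro f hf hd h0 z hz
          by_cases hf0 : f.natDegree = 0
          · exact ihd f hf (by omega) h0 z hz
          have hf1 : 1 ≤ f.natDegree := by omega
          by_cases hl : eval x f.leadingCoeff = 0
          · have hef := (hF f (hGF hf) f (hGF hf) hf1 le_rfl).2.1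
            have hlt := herase f hf1
            rw [ev_eraseLead x f hl] at h0 hz
            exact ihd _ (hlow _ hef (hlt.trans_le (hmax f hf))) (by omega) h0 z hz
          · exact ⟨f, hf, hl, hf1, hz⟩
      have hZsign : ∀ z ∈ Z, SignType.sign ((ev x a).eval z) =
          SignType.sign ((ev x' a).eval (φ z)) := by
        intro z hz
        obtain ⟨f, hf, hfz⟩ := Finset.mem_biUnion.1 hz
        rw [Multiset.mem_toFinset] at hfz
        have hf0 : ev x f ≠ 0 := by
          intro h
          rw [h] at hfz
          simp at hfz
        obtain ⟨g, hg, hgl, hg1, hgz⟩ := hgood _ f hf le_rfl hf0 z (Polynomial.isRoot_of_mem_roots hfz)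
        obtain ⟨-, -, m, q, r, hqr, hrd, hrF⟩ := hF a haF g (hGF hg) hg1 (hmax g hg)
        have hrG := hlow r hrF (hrd.trans_le (hmax g hg))
        have hgz' : (ev x' g).eval (φ z) = 0 := by
          rw [← sign_eq_zero_iff, ← hφ g hg, hgz, sign_zero]
        have hid : ∀ (y : ι → ℝ) (s : ℝ), (ev y g).eval s = 0 →
            SignType.sign (eval y g.leadingCoeff) ^ m * SignType.sign ((ev y a).eval s) =
              SignType.sign ((ev y r).eval s) := by
          intro y s hs
          have h := congrArg (fun p => (ev y p).eval s) hqr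
          simp only [ev, Polynomial.map_mul, Polynomial.map_add, Polynomial.map_pow,
            Polynomial.map_C, Polynomial.eval_mul, Polynomial.eval_add, Polynomial.eval_pow,
            Polynomial.eval_C] at h hs ⊢
          rw [hs, mul_zero, zero_add] at h
          rw [← h, sign_mul, sign_pow]
        have i1 := hid x z hgz
        have i2 := hid x' (φ z) hgz'
        rw [hφ r hrG, ← i2, ← hx g (hGF hg)] at i1
        refine sign_cancel _ _ _ ?_ i1
        rw [← sign_pow, sign_ne_zero]
        exact pow_ne_zero _ hgl
      have hdG : a.derivative ∈ G := hlow _ hda (Polynomial.natDegree_derivative_lt ha0)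
      have hdev : ∀ y, (ev y a).derivative = ev y a.derivative := fun y =>
        Polynomial.derivative_map _ _
      have n1 : (ev x a).natDegree = a.natDegree :=
        Polynomial.natDegree_map_of_leadingCoeff_ne_zero _ hlc
      have n2 : (ev x' a).natDegree = a.natDegree :=
        Polynomial.natDegree_map_of_leadingCoeff_ne_zero _ hlc'
      have l1 : (ev x a).leadingCoeff = eval x a.leadingCoeff :=
        Polynomial.leadingCoeff_map_of_leadingCoeff_ne_zero _ hlc
      have l2 : (ev x' a).leadingCoeff = eval x' a.leadingCoeff :=
        Polynomial.leadingCoeff_map_of_leadingCoeff_ne_zero _ hlc'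
      have hdne : ev x a.derivative ≠ 0 := by
        rw [← hdev]
        intro h
        have := Polynomial.derivative_eq_zero.1 h
        omega
      obtain ⟨ψ, p1, p2⟩ := step φ Z (ev x a) (ev x' a) (by rw [n1, n2]) (by omega)
        (by rw [l1, l2]; exact hx a haF)
        (by intro t; rw [hdev, hdev]; exact hφ _ hdG t)
        (by intro t ht; rw [hdev] at ht; exact hZmem _ hdG hdne t ht) hZsign
      refine ⟨ψ, fun f hf t => ?_⟩
      rcases Finset.mem_insert.1 hf with rfl | hf
      · exact p2 t
      by_cases hf0 : ev x f = 0
      · obtain ⟨s, hs⟩ := φ.surjective (ψ t)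
        rw [← hs, ← hφ f hf, hf0]
        simp
      · rw [hφ f hf t]
        refine sign_transfer φ ψ Z _ (fun s hs => ?_) p1 t
        refine hZmem f hf hf0 s ?_
        rw [← sign_eq_zero_iff, hφ f hf, hs, sign_zero]
  exact key F subset_rfl fun _ _ b hb _ => hb

theorem sa_exists {ι : Type*} {C : Set (Option ι → ℝ)} (hC : IsSemialgebraic C) :
    IsSemialgebraic {x : ι → ℝ | ∃ t : ℝ, (fun o => Option.elim o t x) ∈ C} := by
  classical
  obtain ⟨P, hP⟩ := exists_invariant hC
  obtain ⟨F, hPF, hF⟩ := exists_closed (P.image (optionEquivLeft ℝ ι))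
  refine sa_of_invariant (F.image Polynomial.leadingCoeff) _ ?_
  rintro x x' hxx ⟨t, ht⟩
  obtain ⟨φ, hφ⟩ := main_induction F hF x x' fun f hf =>
    hxx _ (Finset.mem_image_of_mem _ hf)
  refine ⟨φ t, (hP _ _ fun p hp => ?_).1 ht⟩
  rw [optionEquivLeft_elim_eval, optionEquivLeft_elim_eval]
  exact hφ _ (hPF (Finset.mem_image_of_mem _ hp)) t

theorem sa_exists_fin {n : ℕ} (m : ℕ) : ∀ C : Set (Fin n ⊕ Fin m → ℝ), IsSemialgebraic C →
    IsSemialgebraic {x : Fin n → ℝ | ∃ y : Fin m → ℝ, Sum.elim x y ∈ C} := by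
  induction m with
  | zero =>
    intro C hC
    convert sa_preimage (Sum.elim id Fin.elim0 : Fin n ⊕ Fin 0 → Fin n) hC using 1
    ext x
    have h : ∀ y : Fin 0 → ℝ, Sum.elim x y = x ∘ (Sum.elim id Fin.elim0 : Fin n ⊕ Fin 0 → Fin n) := by
      intro y
      funext i
      rcases i with i | i
      · rfl
      · exact i.elim0
    constructor
    · rintro ⟨y, hy⟩
      rw [h y] at hy
      exact hy
    · intro hy
      refine ⟨Fin.elim0, ?_⟩
      rw [h]
      exact hy
  | succ m ih =>
    intro C hC
    let e : Fin n ⊕ Fin (m + 1) → Option (Fin n ⊕ Fin m) :=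
      Sum.elim (fun i => some (Sum.inl i)) (fun j => Fin.cases none (fun k => some (Sum.inr k)) j)
    have h := ih _ (sa_exists (sa_preimage e hC))
    have he : ∀ (x : Fin n → ℝ) (y : Fin m → ℝ) (t : ℝ),
        (fun o => Option.elim o t (Sum.elim x y)) ∘ e = Sum.elim x (Fin.cons t y) := by
      intro x y t
      funext i
      rcases i with i | i
      · rfl
      · refine Fin.cases ?_ (fun k => ?_) i <;> rfl
    convert h using 1
    ext x
    constructor
    · rintro ⟨y, hy⟩
      refine ⟨Fin.tail y, y 0, ?_⟩
      change _ ∘ e ∈ C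
      rw [he, Fin.cons_self_tail]
      exact hy
    · rintro ⟨y, t, hy⟩
      change _ ∘ e ∈ C at hy
      rw [he] at hy
      exact ⟨_, hy⟩

end TS

/-- Tarski–Seidenberg: the projection `π : ℝ^(n+m) → ℝ^n` of a semialgebraic set is
semialgebraic; consequently universal quantification over the projected variables also
preserves semialgebraicity. Here `ℝ^(n+m)` is modeled as `Fin n ⊕ Fin m → ℝ` and the
projection is `v ↦ v ∘ Sum.inl`. -/
theorem tarski_seidenberg (n m : ℕ) :
    (∀ C : Set (Fin n ⊕ Fin m → ℝ), IsSemialgebraic C →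
      IsSemialgebraic ((fun v : Fin n ⊕ Fin m → ℝ => v ∘ Sum.inl) '' C)) ∧
    ∀ C : Set (Fin n ⊕ Fin m → ℝ), IsSemialgebraic C →
      IsSemialgebraic {x : Fin n → ℝ | ∀ y : Fin m → ℝ, Sum.elim x y ∈ C} := by
  constructor
  · intro C hC
    convert TS.sa_exists_fin m C hC using 1
    ext x
    constructor
    · rintro ⟨v, hv, rfl⟩
      refine ⟨v ∘ Sum.inr, ?_⟩
      rw [Sum.elim_comp_inl_inr]
      exact hv
    · rintro ⟨y, hy⟩
      exact ⟨_, hy, by simp⟩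
  · intro C hC
    convert (TS.sa_exists_fin m _ hC.compl).compl using 1
    ext x
    simp
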